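/- Every submodular ultra valuation is M♮-concave: for all A, B ⊆ Ω and x ∈ A \ B, either v(A) + v(B) ≤ v(A \ {x}) + v(B ∪ {x}), or there exists y ∈ B \ A with v(A) + v(B) ≤ v((A \ {x}) ∪ {y}) + v((B \ {y}) ∪ {x}). -/

import Mathlib

def IsUltra {α : Type*} [DecidableEq α] (v : Finset α → ℝ) : Prop :=
  ∀ A B : Finset α, A.card ≤ B.card → ∀ x ∈ A \ B, ∃ y ∈ B \ A,
    v A + v B ≤ v (insert y (A.erase x)) + v (insert x (B.erase y))

def Submodular {α : Type*} [DecidableEq α] (v : Finset α → ℝ) : Prop :=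
  ∀ A B : Finset α, v (A ∪ B) + v (A ∩ B) ≤ v A + v B

section Helpers

variable {α : Type*} [DecidableEq α] {v : Finset α → ℝ}

theorem Submodular.local_exchange (hsub : Submodular v) {B : Finset α} {x z : α}
    (hx : x ∉ B) (hxz : x ≠ z) :
    v B + v (insert x (insert z B)) ≤ v (insert x B) + v (insert z B) := by
  have h := hsub (insert x B) (insert z B)
  have h1 : insert x B ∪ insert z B = insert x (insert z B) := by grind
  have h2 : insert x B ∩ insert z B = B := by grind
  rw [h1, h2] at h
  linarith

theorem IsUltra.local_exchange_erase (hv : IsUltra v) {B : Finset α} {x z y : α}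
    (hx : x ∉ B) (hz : z ∉ B) (hxz : x ≠ z) (hy : y ∈ B) :
    v B + v (insert x (insert z (B.erase y))) ≤ v (insert x (B.erase y)) + v (insert z B) ∨
    v B + v (insert x (insert z (B.erase y))) ≤ v (insert x B) + v (insert z (B.erase y)) := by
  have hcard : B.card ≤ (insert x (insert z (B.erase y))).card := by
    rw [Finset.card_insert_of_notMem (by grind), Finset.card_insert_of_notMem (by grind),
      Finset.card_erase_of_mem hy]
    omega
  obtain ⟨w, hw, h⟩ := hv B _ hcard y (by grind)
  obtain rfl | rfl : w = x ∨ w = z := by grind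
  · left
    have h1 : insert y ((insert w (insert z (B.erase y))).erase w) = insert z B := by grind
    rwa [h1] at h
  · right
    have h1 : insert y ((insert x (insert w (B.erase y))).erase w) = insert x B := by grind
    rw [h1] at h
    linarith

theorem IsUltra.local_exchange_erase_erase (hv : IsUltra v) {B : Finset α} {x z y y' : α}
    (hx : x ∉ B) (hz : z ∉ B) (hxz : x ≠ z) (hy : y ∈ B) (hy' : y' ∈ B) (hyy : y ≠ y') :
    v B + v (insert x (insert z ((B.erase y).erase y'))) ≤
      v (insert x (B.erase y)) + v (insert z (B.erase y')) ∨
    v B + v (insert x (insert z ((B.erase y).erase y'))) ≤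
      v (insert x (B.erase y')) + v (insert z (B.erase y)) := by
  have hcard : (insert x (insert z ((B.erase y).erase y'))).card ≤ B.card := by
    have hpos : 2 ≤ B.card := Finset.one_lt_card.2 ⟨y, hy, y', hy', hyy⟩
    rw [Finset.card_insert_of_notMem (by grind), Finset.card_insert_of_notMem (by grind),
      Finset.card_erase_of_mem (by grind), Finset.card_erase_of_mem hy]
    omega
  obtain ⟨w, hw, h⟩ := hv _ B hcard x (by grind)
  obtain rfl | rfl : w = y ∨ w = y' := by grind
  · left
    have h1 : insert w ((insert x (insert z ((B.erase w).erase y'))).erase x) =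
      insert z (B.erase y') := by grind
    rw [h1] at h
    linarith
  · right
    have h1 : insert w ((insert x (insert z ((B.erase y).erase w))).erase x) =
      insert z (B.erase y) := by grind
    rw [h1] at h
    linarith

/-- The exchange property for a valuation normalized so that removing `x` from `A`, or
exchanging it for any element outside `A`, does not change the value. -/
theorem exchange_of_normalized (hsub : Submodular v) (hv : IsUltra v) {A : Finset α} {x : α}
    (hxA : x ∈ A) (herase : v (A.erase x) = v A)
    (hswap : ∀ y ∉ A, v (insert y (A.erase x)) = v A) (B : Finset α) (hxB : x ∉ B) :
    v B ≤ v (insert x B) ∨ ∃ y ∈ B \ A, v B ≤ v (insert x (B.erase y)) := by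
  induction hn : (A \ B).card using Nat.strong_induction_on generalizing B with
  | _ n ih =>
  by_cases hcard : A.card ≤ B.card
  · obtain ⟨y, hy, h⟩ := hv A B hcard x (by grind)
    rw [hswap y (Finset.mem_sdiff.1 hy).2] at h
    exact .inr ⟨y, hy, by linarith⟩
  by_cases hz : ∃ z ∈ A \ B, z ≠ x
  · obtain ⟨z, hzAB, hzx⟩ := hz
    obtain ⟨hzA, hzB⟩ := Finset.mem_sdiff.1 hzAB
    by_contra! hcon
    obtain ⟨hlt, hlt'⟩ := hcon
    have hmeasure : ∀ S, B ∩ A ⊆ S → (A \ insert z S).card < n := by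
      intro S hS
      rw [← hn]
      refine Finset.card_lt_card ((Finset.ssubset_iff_of_subset fun a ha => ?_).2 ⟨z, hzAB, by simp⟩)
      have := @hS a
      simp only [Finset.mem_sdiff, Finset.mem_insert, Finset.mem_inter] at *
      tauto
    obtain ⟨S, hS, hmax⟩ := (insert B ((B \ A).image B.erase)).exists_max_image
      (fun S => v (insert z S)) ⟨B, Finset.mem_insert_self _ _⟩
    have hmaxB := hmax B (Finset.mem_insert_self _ _)
    have hmax' : ∀ y ∈ B \ A, v (insert z (B.erase y)) ≤ v (insert z S) := fun y hy =>
      hmax _ (Finset.mem_insert_of_mem (Finset.mem_image_of_mem _ hy))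
    rw [Finset.mem_insert, Finset.mem_image] at hS
    obtain rfl | ⟨y₀, hy₀, rfl⟩ := hS
    · obtain h | ⟨y, hy, h⟩ := ih _ (hmeasure S Finset.inter_subset_left) (insert z S) (by grind) rfl
      · linarith [hsub.local_exchange hxB hzx.symm]
      · have hyS : y ∈ S \ A := by grind
        rw [Finset.erase_insert_of_ne (by grind)] at h
        obtain h' | h' := hv.local_exchange_erase hxB hzB hzx.symm (Finset.mem_sdiff.1 hyS).1 <;>
          linarith [hlt' y hyS, hmax' y hyS]
    · obtain h | ⟨y, hy, h⟩ := ih _ (hmeasure (B.erase y₀) (by clear hmax hmax' ih; grind))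
        (insert z (B.erase y₀)) (by grind) rfl
      · obtain h' | h' := hv.local_exchange_erase hxB hzB hzx.symm (Finset.mem_sdiff.1 hy₀).1 <;>
          linarith [hlt' y₀ hy₀]
      · have hyB : y ∈ B \ A := by grind
        rw [Finset.erase_insert_of_ne (by grind)] at h
        obtain h' | h' := hv.local_exchange_erase_erase hxB hzB hzx.symm
          (Finset.mem_sdiff.1 hy₀).1 (Finset.mem_sdiff.1 hyB).1 (by grind) <;>
          linarith [hlt' y hyB, hlt' y₀ hy₀, hmax' y hyB]
  · push Not at hz
    have hAB : A \ B = {x} := by grind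
    have hBA : B \ A = ∅ := by
      have h1 := Finset.card_sdiff_add_card_inter A B
      have h2 := Finset.card_sdiff_add_card_inter B A
      rw [hAB, Finset.card_singleton] at h1
      rw [Finset.inter_comm] at h2
      exact Finset.card_eq_zero.1 (by omega)
    have hB : B = A.erase x := by
      rw [Finset.erase_eq, ← hAB, Finset.sdiff_sdiff_eq_self (Finset.sdiff_eq_empty_iff_subset.1 hBA)]
    left
    rw [hB, Finset.insert_erase hxA, herase]

theorem Submodular.add_sum (hsub : Submodular v) (p : α → ℝ) :
    Submodular fun X => v X + ∑ i ∈ X, p i := by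
  intro A B
  have := Finset.sum_union_inter (s₁ := A) (s₂ := B) (f := p)
  have := hsub A B
  dsimp only
  linarith

theorem sum_insert_erase {X : Finset α} {x y : α} (hx : x ∈ X) (hy : y ∉ X) (p : α → ℝ) :
    ∑ i ∈ insert y (X.erase x), p i = ∑ i ∈ X, p i - p x + p y := by
  rw [Finset.sum_insert (by grind), Finset.sum_erase_eq_sub hx]
  ring

theorem IsUltra.add_sum (hv : IsUltra v) (p : α → ℝ) :
    IsUltra fun X => v X + ∑ i ∈ X, p i := by
  intro A B hcard x hx
  obtain ⟨y, hy, h⟩ := hv A B hcard x hx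
  refine ⟨y, hy, ?_⟩
  rw [Finset.mem_sdiff] at hx hy
  dsimp only
  rw [sum_insert_erase hx.1 hy.2, sum_insert_erase hy.1 hx.2]
  linarith

end Helpers

/-- Every submodular ultra valuation is M♮-concave. -/
theorem submodular_ultra_Mnat {α : Type*} [Fintype α] [DecidableEq α]
    (v : Finset α → ℝ) (hsub : Submodular v) (hv : IsUltra v) :
    ∀ A B : Finset α, ∀ x ∈ A \ B,
      v A + v B ≤ v (A.erase x) + v (insert x B) ∨
      ∃ y ∈ B \ A,
        v A + v B ≤ v (insert y (A.erase x)) + v (insert x (B.erase y)) := by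
  intro A B x hx
  obtain ⟨hxA, hxB⟩ := Finset.mem_sdiff.1 hx
  let q : ℝ := v (A.erase x) - v A
  let p : α → ℝ := fun y => if y = x then q else q + v A - v (insert y (A.erase x))
  have hpx : p x = q := if_pos rfl
  have hp : ∀ y ∉ A, p y = q + v A - v (insert y (A.erase x)) := fun y hy =>
    if_neg (ne_of_mem_of_not_mem hxA hy).symm
  obtain h | ⟨y, hy, h⟩ := exchange_of_normalized (hsub.add_sum p) (hv.add_sum p) hxA
    (by rw [Finset.sum_erase_eq_sub hxA, hpx]; ring)
    (fun y hy => by rw [sum_insert_erase hxA hy, hpx, hp y hy]; ring) B hxB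
  · left
    rw [Finset.sum_insert hxB, hpx] at h
    linarith
  · right
    obtain ⟨hyB, hyA⟩ := Finset.mem_sdiff.1 hy
    rw [sum_insert_erase hyB hxB, hpx, hp y hyA] at h
    exact ⟨y, hy, by linarith⟩
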